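/- Let G be a minimal counterexample and let S be a nonempty proper subset of V(G). If G' is the assigned graph obtained from G by reassigning at most two vertices of S from U to F (leaving all other assignments unchanged), then the induced assigned subgraph G'[S] has an I,F-partition extending its assignment. -/

import Mathlib

open SimpleGraph

noncomputable def edgeCount {V : Type*} (G : SimpleGraph V) : ℕ := Nat.card G.edgeSet

noncomputable def deg {V : Type*} (G : SimpleGraph V) (v : V) : ℕ := Nat.card (G.neighborSet v)

def TwoIndependent {V : Type*} (G : SimpleGraph V) (S : Set V) : Prop :=
  ∀ u ∈ S, ∀ v ∈ S, u ≠ v → ¬ G.Adj u v ∧ ∀ w, ¬ (G.Adj u w ∧ G.Adj w v)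

def IsIFPartition {V : Type*} (G : SimpleGraph V) (A B : Set V) : Prop :=
  A ∪ B = Set.univ ∧ Disjoint A B ∧ TwoIndependent G A ∧ (G.induce B).IsAcyclic

def IsAssignment {V : Type*} (I F U : Set V) : Prop :=
  I ∪ F ∪ U = Set.univ ∧ Disjoint I F ∧ Disjoint I U ∧ Disjoint F U

noncomputable def rho {V : Type*} (G : SimpleGraph V) (I F U : Set V) (H : G.Subgraph) : ℤ :=
  (H.verts ∩ I).ncard + 4 * (H.verts ∩ F).ncard + 5 * (H.verts ∩ U).ncard
    - 4 * Nat.card H.edgeSet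

noncomputable def rhoSet {V : Type*} (G : SimpleGraph V) (I F U : Set V) (S : Set V) : ℤ :=
  (S ∩ I).ncard + 4 * (S ∩ F).ncard + 5 * (S ∩ U).ncard - 4 * edgeCount (G.induce S)

def IsCounterexample {V : Type*} [Fintype V] (G : SimpleGraph V) (I F U : Set V) : Prop :=
  IsAssignment I F U ∧
  (∀ H : G.Subgraph, H.verts.Nonempty → 0 < rho G I F U H) ∧
  ¬ ∃ A B : Set V, IsIFPartition G A B ∧ I ⊆ A ∧ F ⊆ B

def IsMinCounterexample {V : Type*} [Fintype V] (G : SimpleGraph V) (I F U : Set V) : Prop :=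
  IsCounterexample G I F U ∧
  ∀ (n : ℕ) (G' : SimpleGraph (Fin n)) (I' F' U' : Set (Fin n)),
    IsCounterexample G' I' F' U' →
    Fintype.card V + edgeCount G ≤ n + edgeCount G'

def IsThread {V : Type*} (G : SimpleGraph V) (I F U : Set V) (p : List V) : Prop :=
  p ≠ [] ∧ p.Nodup ∧ p.Chain' G.Adj ∧ (∀ v ∈ p, v ∈ U ∧ deg G v = 2) ∧
  (∀ w, w ∉ p → (∃ a ∈ p, G.Adj a w) → 3 ≤ deg G w ∨ w ∈ I ∪ F)

def BordersThread {V : Type*} (G : SimpleGraph V) (p : List V) (w : V) : Prop :=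
  w ∉ p ∧ ∃ a ∈ p, G.Adj a w

def IsStarForest {V : Type*} (H : SimpleGraph V) : Prop :=
  H.IsAcyclic ∧ ∀ a b c d : V, H.Adj a b → H.Adj b c → H.Adj c d → a = c ∨ b = d

def IsStarColoring {V : Type*} {k : ℕ} (G : SimpleGraph V) (c : V → Fin k) : Prop :=
  (∀ u v, G.Adj u v → c u ≠ c v) ∧
  ∀ i j : Fin k, IsStarForest (G.induce {v | c v = i ∨ c v = j})

def StarColorable {V : Type*} (G : SimpleGraph V) (k : ℕ) : Prop :=
  ∃ c : V → Fin k, IsStarColoring G c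

def MadLt {V : Type*} (G : SimpleGraph V) (q : ℚ) : Prop :=
  ∀ H : G.Subgraph, H.verts.Nonempty →
    (2 * (Nat.card H.edgeSet : ℚ)) / (H.verts.ncard : ℚ) < q


set_option linter.unusedSectionVars false

open scoped Classical in
/-- Adjacency indicator. -/
noncomputable def ad {V : Type*} (G : SimpleGraph V) (u v : V) : ℤ := if G.Adj u v then 1 else 0

/-- Number of adjacent ordered pairs between two finite sets. -/
noncomputable def cr {V : Type*} (G : SimpleGraph V) (X Y : Finset V) : ℤ :=
  ∑ u ∈ X, ∑ v ∈ Y, ad G u v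

/-- Potential of a finite vertex set, for a weight function. -/
noncomputable def pot {V : Type*} (G : SimpleGraph V) (w : V → ℤ) (X : Finset V) : ℤ :=
  ∑ v ∈ X, w v - 2 * cr G X X

/-- Counting form of acyclicity of the subgraph induced by `K`. -/
def Spr {V : Type*} (G : SimpleGraph V) (K : Set V) : Prop :=
  ∀ X : Finset V, (∀ x ∈ X, x ∈ K) → X.Nonempty → cr G X X + 2 ≤ 2 * (X.card : ℤ)

/-- `A` is the independent part of a partition of the subgraph induced by `K`. -/
structure IFPart {V : Type*} (G : SimpleGraph V) (w : V → ℤ) (K : Finset V) (A : Finset V) :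
    Prop where
  sub : ∀ x ∈ A, x ∈ K
  nadj : ∀ u ∈ A, ∀ v ∈ A, u ≠ v → ¬ G.Adj u v
  ncom : ∀ u ∈ A, ∀ v ∈ A, u ≠ v → ∀ m ∈ K, G.Adj u m → G.Adj m v → False
  spr : Spr G {x | x ∈ K ∧ x ∉ A}
  one : ∀ v ∈ K, w v = 1 → v ∈ A
  four : ∀ v ∈ K, w v = 4 → v ∉ A

section basics
variable {V : Type*} (G : SimpleGraph V)

lemma ad_nonneg (u v : V) : 0 ≤ ad G u v := by unfold ad; split_ifs <;> simp
lemma ad_le (u v : V) : ad G u v ≤ 1 := by unfold ad; split_ifs <;> simp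
lemma ad_comm (u v : V) : ad G u v = ad G v u := by
  unfold ad; rw [show G.Adj u v = G.Adj v u from propext (G.adj_comm u v)]
lemma ad_self (u : V) : ad G u u = 0 := by simp [ad]
lemma ad_of {u v : V} (h : G.Adj u v) : ad G u v = 1 := by simp [ad, h]
lemma ad_not {u v : V} (h : ¬ G.Adj u v) : ad G u v = 0 := by simp [ad, h]

lemma cr_nonneg (X Y : Finset V) : 0 ≤ cr G X Y :=
  Finset.sum_nonneg fun _ _ => Finset.sum_nonneg fun _ _ => ad_nonneg _ _ _

lemma cr_comm (X Y : Finset V) : cr G X Y = cr G Y X := by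
  unfold cr; rw [Finset.sum_comm]
  exact Finset.sum_congr rfl fun _ _ => Finset.sum_congr rfl fun _ _ => ad_comm _ _ _

lemma cr_mono {X X' Y Y' : Finset V} (h : X ⊆ X') (h' : Y ⊆ Y') : cr G X Y ≤ cr G X' Y' := by
  unfold cr
  calc _ ≤ ∑ u ∈ X, ∑ v ∈ Y', ad G u v :=
        Finset.sum_le_sum fun u _ =>
          Finset.sum_le_sum_of_subset_of_nonneg h' fun _ _ _ => ad_nonneg _ _ _
    _ ≤ _ := Finset.sum_le_sum_of_subset_of_nonneg h fun _ _ _ =>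
        Finset.sum_nonneg fun _ _ => ad_nonneg _ _ _

lemma cr_ge_one {X Y : Finset V} {u v : V} (hu : u ∈ X) (hv : v ∈ Y) (h : G.Adj u v) :
    1 ≤ cr G X Y := by
  have := cr_mono G (X := {u}) (X' := X) (Y := {v}) (Y' := Y) (by simpa) (by simpa)
  simpa [cr, ad_of G h] using this

lemma exists_of_cr_ne {X Y : Finset V} (h : cr G X Y ≠ 0) : ∃ u ∈ X, ∃ v ∈ Y, G.Adj u v := by
  by_contra hc
  push Not at hc
  exact h (Finset.sum_eq_zero fun u hu => Finset.sum_eq_zero fun v hv => ad_not G (hc u hu v hv))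

lemma cr_le_card (X Y : Finset V) (h : ∀ y ∈ Y, ∀ x ∈ X, ∀ x' ∈ X, G.Adj y x → G.Adj y x' → x = x') :
    ∀ y ∈ Y, ∑ x ∈ X, ad G y x ≤ 1 := by
  intro y hy
  by_cases hx : ∃ x ∈ X, G.Adj y x
  · obtain ⟨x, hx, hxy⟩ := hx
    rw [Finset.sum_eq_single_of_mem x hx]
    · exact ad_le _ _ _
    · intro b hb hbx
      exact ad_not G fun hh => hbx (h y hy b hb x hx hh hxy)
  · push Not at hx
    rw [Finset.sum_eq_zero fun x h' => ad_not G (hx x h')]; simp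

variable [DecidableEq V]

lemma cr_union {X Y : Finset V} (h : Disjoint X Y) :
    cr G (X ∪ Y) (X ∪ Y) = cr G X X + cr G Y Y + 2 * cr G X Y := by
  have h1 : cr G (X ∪ Y) (X ∪ Y) = cr G X X + cr G X Y + (cr G Y X + cr G Y Y) := by
    unfold cr
    rw [Finset.sum_union h]
    simp_rw [Finset.sum_union h, Finset.sum_add_distrib]
  rw [h1, cr_comm G Y X]; ring

lemma pot_union (w : V → ℤ) {X Y : Finset V} (h : Disjoint X Y) :
    pot G w (X ∪ Y) = pot G w X + pot G w Y - 4 * cr G X Y := by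
  unfold pot; rw [cr_union G h, Finset.sum_union h]; ring

lemma pot_singleton (w : V → ℤ) (v : V) : pot G w {v} = w v := by
  simp [pot, cr, ad_self]

lemma cr_two_le {X : Finset V} {y s t : V} (hs : s ∈ X) (ht : t ∈ X) (hst : s ≠ t)
    (h1 : G.Adj y s) (h2 : G.Adj y t) : 2 ≤ cr G {y} X := by
  have := cr_mono G (X := {y}) (X' := {y}) (Y := {s, t}) (Y' := X) (by simp)
    (by intro a; simp; rintro (rfl | rfl) <;> assumption)
  simpa [cr, Finset.sum_pair hst, ad_of G h1, ad_of G h2] using this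

lemma cr_self_le (X : Finset V) : cr G X X ≤ (X.card : ℤ) * (X.card - 1) := by
  have : ∀ u ∈ X, ∑ v ∈ X, ad G u v ≤ (X.card : ℤ) - 1 := by
    intro u hu
    rw [← Finset.add_sum_erase X _ hu, ad_self]
    have h1 : ∑ v ∈ X.erase u, ad G u v ≤ ∑ v ∈ X.erase u, (1 : ℤ) :=
      Finset.sum_le_sum fun _ _ => ad_le _ _ _
    have h2 := Finset.card_erase_add_one hu
    simp at h1
    omega
  calc cr G X X ≤ ∑ u ∈ X, ((X.card : ℤ) - 1) := Finset.sum_le_sum this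
    _ = _ := by simp [mul_sub]

lemma Spr.mono {G : SimpleGraph V} {K K' : Set V} (h : Spr G K) (hk : K' ⊆ K) : Spr G K' :=
  fun X hX => h X fun x hx => hk (hX x hx)

end basics

universe u

/-- Abstract minimal counterexample. -/
structure MinC {V : Type u} [Fintype V] (G : SimpleGraph V) (w : V → ℤ) : Prop where
  val : ∀ v, w v = 1 ∨ w v = 4 ∨ w v = 5
  pos : ∀ T : Finset V, T.Nonempty → 0 < pot G w T
  no : ¬ ∃ A, IFPart G w Finset.univ A
  mini : ∀ (W : Type u) [Fintype W] (G2 : SimpleGraph W) (w2 : W → ℤ) (K : Finset W),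
    (∀ v, w2 v = 1 ∨ w2 v = 4 ∨ w2 v = 5) →
    (∀ T : Finset W, T ⊆ K → T.Nonempty → 0 < pot G2 w2 T) →
    2 * (K.card : ℤ) + cr G2 K K <
      2 * ((Finset.univ : Finset V).card : ℤ) + cr G Finset.univ Finset.univ →
    ∃ A, IFPart G2 w2 K A

/-- The gadget graph. -/
def Gd {V : Type u} (G : SimpleGraph V) (S : Finset V) (f : V → Bool) (e : Prop) :
    SimpleGraph (V ⊕ Bool) where
  Adj a b := match a, b with
    | .inl u, .inl v => G.Adj u v
    | .inl u, .inr t => (∃ s ∈ S, G.Adj u s) ∧ f u = t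
    | .inr t, .inl u => (∃ s ∈ S, G.Adj u s) ∧ f u = t
    | .inr s, .inr t => e ∧ s ≠ t
  symm := ⟨by
    rintro (a | a) (b | b) h
    · exact SimpleGraph.Adj.symm (G := G) h
    · exact h
    · exact h
    · exact ⟨h.1, h.2.symm⟩⟩
  loopless := ⟨by
    rintro (a | a) h
    · exact G.loopless.irrefl a h
    · exact h.2 rfl⟩

open scoped Classical in
/-- Weights of the gadget graph. -/
noncomputable def wd {V : Type u} (w : V → ℤ) (e : Prop) : V ⊕ Bool → ℤ
  | .inl v => w v
  | .inr t => if e ∧ t = true then 5 else 1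

section gadget
variable {V : Type u} [DecidableEq V] {G : SimpleGraph V} {S : Finset V} {f : V → Bool}
  {e : Prop} {w : V → ℤ}

@[simp] lemma Gd_ll (u v : V) : (Gd G S f e).Adj (.inl u) (.inl v) ↔ G.Adj u v := Iff.rfl
@[simp] lemma Gd_lr (u : V) (t : Bool) :
    (Gd G S f e).Adj (.inl u) (.inr t) ↔ (∃ s ∈ S, G.Adj u s) ∧ f u = t := Iff.rfl
@[simp] lemma Gd_rl (u : V) (t : Bool) :
    (Gd G S f e).Adj (.inr t) (.inl u) ↔ (∃ s ∈ S, G.Adj u s) ∧ f u = t := Iff.rfl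
@[simp] lemma Gd_rr (s t : Bool) :
    (Gd G S f e).Adj (.inr s) (.inr t) ↔ e ∧ s ≠ t := Iff.rfl

lemma ad_ll (u v : V) : ad (Gd G S f e) (.inl u) (.inl v) = ad G u v := rfl

/-- Lifting a partition of the gadget graph. -/
lemma gadget_lift [Fintype V] {A : Finset V} {A2 : Finset (V ⊕ Bool)}
    (hA : IFPart G w S A) (hA2 : IFPart (Gd G S f e) (wd w e) (Sᶜ.disjSum Finset.univ) A2)
    (huniq : ∀ y, y ∉ S → ∀ s ∈ S, ∀ t ∈ S, G.Adj y s → G.Adj y t → s = t)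
    (hf : ∀ y, y ∉ S → ∀ s ∈ S, G.Adj y s → (s ∈ A ↔ Sum.inr (f y) ∈ A2)) :
    IFPart G w Finset.univ (A ∪ A2.toLeft) := by
  have hfalse : Sum.inr false ∈ A2 := hA2.one _ (by simp) (by simp [wd])
  have htrue : Sum.inr true ∉ A2 → e := by
    intro h
    by_contra he
    exact h (hA2.one _ (by simp) (by simp [wd, he]))
  have hL : ∀ y, Sum.inl y ∈ A2 → y ∉ S := by
    intro y hy
    simpa using hA2.sub _ hy
  have hb : ∀ t, Sum.inr t ∉ A2 → t = true := by
    intro t ht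
    cases t
    · exact absurd hfalse ht
    · rfl
  -- mixed pairs
  have hmix1 : ∀ a ∈ A, ∀ y, Sum.inl y ∈ A2 → ¬ G.Adj a y := by
    intro a ha y hy hadj
    have h1 := (hf y (hL y hy) a (hA.sub a ha) hadj.symm).1 ha
    exact hA2.nadj _ hy _ h1 (by simp) ⟨⟨a, hA.sub a ha, hadj.symm⟩, rfl⟩
  have hmix2 : ∀ a ∈ A, ∀ y, Sum.inl y ∈ A2 → ∀ m, G.Adj a m → G.Adj m y → False := by
    intro a ha y hy m h1 h2
    have haS := hA.sub a ha
    by_cases hm : m ∈ S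
    · have hmA : m ∉ A := fun hmA => hA.nadj a ha m hmA h1.ne h1
      have h3 : Sum.inr (f y) ∉ A2 := fun h => hmA ((hf y (hL y hy) m hm h2.symm).2 h)
      have h4 := hb _ h3
      have he := htrue (h4 ▸ h3)
      refine hA2.ncom _ hy _ hfalse (by simp) (.inr true) (by simp) ?_ ?_
      · exact ⟨⟨m, hm, h2.symm⟩, h4⟩
      · exact ⟨he, by simp⟩
    · have h3 := (hf m hm a haS h1.symm).1 ha
      refine hA2.ncom _ h3 _ hy (by simp) (.inl m) (by simpa using hm) ?_ h2
      exact ⟨⟨a, haS, h1.symm⟩, rfl⟩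
  refine ⟨by simp, ?_, ?_, ?_, ?_, ?_⟩
  · intro u hu v hv huv hadj
    simp only [Finset.mem_union, Finset.mem_toLeft] at hu hv
    rcases hu with hu | hu <;> rcases hv with hv | hv
    · exact hA.nadj u hu v hv huv hadj
    · exact hmix1 u hu v hv hadj
    · exact hmix1 v hv u hu hadj.symm
    · exact hA2.nadj _ hu _ hv (by simpa using huv) hadj
  · intro u hu v hv huv m _ h1 h2
    simp only [Finset.mem_union, Finset.mem_toLeft] at hu hv
    rcases hu with hu | hu <;> rcases hv with hv | hv
    · by_cases hm : m ∈ S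
      · exact hA.ncom u hu v hv huv m hm h1 h2
      · exact huv (huniq m hm u (hA.sub u hu) v (hA.sub v hv) h1.symm h2)
    · exact hmix2 u hu v hv m h1 h2
    · exact hmix2 v hv u hu m h2.symm h1.symm
    · by_cases hm : m ∈ S
      · by_cases hmA : m ∈ A
        · exact hmix1 m hmA u hu h1.symm
        · have h3 : Sum.inr (f u) ∉ A2 := fun h => hmA ((hf u (hL u hu) m hm h1).2 h)
          have h4 : Sum.inr (f v) ∉ A2 := fun h => hmA ((hf v (hL v hv) m hm h2.symm).2 h)
          refine hA2.ncom _ hu _ hv (by simpa using huv) (.inr true) (by simp) ?_ ?_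
          · exact ⟨⟨m, hm, h1⟩, hb _ h3⟩
          · exact ⟨⟨m, hm, h2.symm⟩, hb _ h4⟩
      · exact hA2.ncom _ hu _ hv (by simpa using huv) (.inl m) (by simpa using hm) h1 h2
  · intro X hX hXne
    simp only [Set.mem_ofPred_eq, Finset.mem_union, Finset.mem_toLeft, not_or, Finset.mem_univ,
      true_and] at hX
    set X1 := X.filter (· ∈ S) with hX1
    set X2 := X.filter (· ∉ S) with hX2
    have hd : Disjoint X1 X2 := Finset.disjoint_filter_filter_not _ _ _
    have hU : X1 ∪ X2 = X := Finset.filter_union_filter_not_eq _ _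
    have hc : (X.card : ℤ) = X1.card + X2.card := by
      rw [← hU, Finset.card_union_of_disjoint hd]; push_cast; rfl
    rw [← hU, cr_union G hd, hU, hc]
    have s1 : X1.Nonempty → cr G X1 X1 + 2 ≤ 2 * (X1.card : ℤ) := hA.spr X1 (by
      intro x hx
      simp only [hX1, Finset.mem_filter] at hx
      exact ⟨hx.2, (hX x hx.1).1⟩)
    have s2 : X2.Nonempty → cr G X2 X2 + 2 ≤ 2 * (X2.card : ℤ) := by
      intro hne
      have := hA2.spr (X2.disjSum ∅) (by
        intro x hx
        rcases x with x | x
        · simp [hX2] at hx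
          exact ⟨by simpa using hx.2, (hX x hx.1).2⟩
        · simp at hx) (by
          obtain ⟨x, hx⟩ := hne
          exact ⟨.inl x, by simpa using hx⟩)
      simpa [cr, ad_ll] using this
    by_cases hz : cr G X1 X2 = 0
    · rw [hz]
      rcases X1.eq_empty_or_nonempty with h1 | h1
      · rcases X2.eq_empty_or_nonempty with h2 | h2
        · rw [h1, h2] at hU
          simp [← hU] at hXne
        · have := s2 h2
          simp [h1, cr] at this ⊢
          exact this
      · rcases X2.eq_empty_or_nonempty with h2 | h2
        · have := s1 h1
          simp [h2, cr] at this ⊢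
          exact this
        · have := s1 h1
          have := s2 h2
          linarith
    · have key : ∀ x ∈ X2, ∀ s ∈ X1, G.Adj x s → Sum.inr (f x) ∉ A2 := by
        intro x hx s hs hadj hmem
        simp only [hX1, hX2, Finset.mem_filter] at hx hs
        exact (hX s hs.1).1 ((hf x hx.2 s hs.2 hadj).2 hmem)
      obtain ⟨s0, hs0, x0, hx0, hadj0⟩ := exists_of_cr_ne G hz
      have ht0 : Sum.inr true ∉ A2 := by
        have := key x0 hx0 s0 hs0 hadj0.symm
        rwa [hb _ this] at this
      have s3 := hA2.spr (X2.disjSum {true}) (by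
        intro x hx
        rcases x with x | x
        · simp [hX2] at hx
          exact ⟨by simpa using hx.2, (hX x hx.1).2⟩
        · simp at hx
          subst hx
          exact ⟨by simp, ht0⟩) ⟨.inr true, by simp⟩
      have s4 : cr G X1 X2 ≤ ∑ x ∈ X2, ad (Gd G S f e) (.inl x) (.inr true) := by
        rw [cr_comm]
        refine Finset.sum_le_sum fun x hx => ?_
        by_cases hh : ∃ s ∈ X1, G.Adj x s
        · obtain ⟨s, hs, hadj⟩ := hh
          have h5 := hb _ (key x hx s hs hadj)
          rw [ad_of (Gd G S f e) (u := .inl x) (v := .inr true)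
            ⟨⟨s, (Finset.mem_filter.1 hs).2, hadj⟩, h5⟩]
          refine cr_le_card G X1 X2 ?_ x hx
          intro y hy s hs t ht
          exact huniq y (Finset.mem_filter.1 hy).2 s (Finset.mem_filter.1 hs).2 t
            (Finset.mem_filter.1 ht).2
        · push Not at hh
          rw [Finset.sum_eq_zero fun s hs => ad_not G (hh s hs)]
          exact ad_nonneg _ _ _
      have s5 : cr (Gd G S f e) (X2.disjSum {true}) (X2.disjSum {true}) =
          cr G X2 X2 + 2 * ∑ x ∈ X2, ad (Gd G S f e) (.inl x) (.inr true) := by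
        simp only [cr, Finset.sum_disjSum, Finset.sum_singleton, Finset.sum_add_distrib, ad_ll,
          ad_self, ad_comm _ (Sum.inr true)]
        ring
      rw [s5, Finset.card_disjSum] at s3
      have := s1 ⟨s0, hs0⟩
      push_cast at s3
      simp at s3
      linarith
  · intro v _ hv
    by_cases hS : v ∈ S
    · exact Finset.mem_union_left _ (hA.one v hS hv)
    · refine Finset.mem_union_right _ ?_
      rw [Finset.mem_toLeft]
      exact hA2.one _ (by simpa using hS) (by simpa [wd] using hv)
  · intro v _ hv hmem
    simp only [Finset.mem_union, Finset.mem_toLeft] at hmem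
    rcases hmem with h | h
    · exact hA.four v (hA.sub v h) hv h
    · exact hA2.four _ (hA2.sub _ h) (by simpa [wd] using hv) h

end gadget

section core
variable {V : Type u} [Fintype V] [DecidableEq V] {G : SimpleGraph V} {w : V → ℤ}

lemma MinC.wpos (h : MinC G w) (v : V) : 1 ≤ w v := by
  rcases h.val v with h | h | h <;> omega

lemma MinC.wle (h : MinC G w) (v : V) : w v ≤ 5 := by
  rcases h.val v with h | h | h <;> omega

/-- Any proper induced subgraph has a partition, after suitable reassignments. -/
lemma MinC.sub (h : MinC G w) {S : Finset V} (hS : S ≠ Finset.univ) (M : Finset V)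
    (hM : ∀ T : Finset V, T ⊆ S → T.Nonempty →
      ∑ v ∈ T, (if v ∈ M then w v - 4 else 0) < pot G w T) :
    ∃ A, IFPart G (fun v => if v ∈ M then 4 else w v) S A := by
  apply h.mini
  · intro v
    have := h.val v
    by_cases hv : v ∈ M <;> simp [hv, this]
  · intro T hT hne
    have := hM T hT hne
    have h2 : ∑ v ∈ T, (if v ∈ M then (4 : ℤ) else w v) =
        ∑ v ∈ T, w v - ∑ v ∈ T, (if v ∈ M then w v - 4 else 0) := by
      rw [← Finset.sum_sub_distrib]
      refine Finset.sum_congr rfl fun v _ => ?_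
      split_ifs <;> ring
    unfold pot at this ⊢
    rw [h2]; linarith
  · have h1 : S.card < (Finset.univ : Finset V).card :=
      Finset.card_lt_card (Finset.ssubset_univ_iff.2 hS)
    have h2 := cr_mono G (Finset.subset_univ S) (Finset.subset_univ S)
    have h3 : (S.card : ℤ) < (Finset.univ : Finset V).card := by exact_mod_cast h1
    linarith

lemma MinC.sub0 (h : MinC G w) {S : Finset V} (hS : S ≠ Finset.univ) :
    ∃ A, IFPart G w S A := by
  simpa using h.sub hS ∅ (by simpa using fun T _ hT => h.pos T hT)

/-- A vertex outside a set of small potential has at most one neighbour in it. -/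
lemma MinC.uniq (h : MinC G w) {S : Finset V} (hp : pot G w S ≤ 2) :
    ∀ y, y ∉ S → ∀ s ∈ S, ∀ t ∈ S, G.Adj y s → G.Adj y t → s = t := by
  intro y hy s hs t ht h1 h2
  by_contra hst
  have h3 := cr_two_le G hs ht hst h1 h2
  have h4 := h.pos ({y} ∪ S) ⟨y, by simp⟩
  rw [pot_union G w (by simpa using hy), pot_singleton] at h4
  have := h.wle y
  linarith

open scoped Classical in
/-- The main gadget argument. -/
lemma MinC.gadget (h : MinC G w) {S A : Finset V} (f : V → Bool) (e : Prop)
    (hA : IFPart G w S A) (hp : pot G w S ≤ 2)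
    (hcard : 3 ≤ S.card) (hcr : 1 ≤ cr G S S)
    (hf1 : e → ∀ y, y ∉ S → ∀ s ∈ S, G.Adj y s → (s ∈ A ↔ f y = false))
    (hf2 : ¬ e → ∀ y, y ∉ S → ∀ s ∈ S, G.Adj y s → s ∈ A)
    (hH : ∀ L : Finset V, Disjoint L S → L.Nonempty → ∀ t : Bool, (e → t = false) →
      (∀ y ∈ L, (∃ s ∈ S, G.Adj y s) → f y = t) → pot G w S ≤ pot G w (L ∪ S)) : False := by
  -- the edges between the left part and the gadget
  set b : Finset V → Finset Bool → ℤ := fun L R =>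
    ∑ u ∈ L, ∑ t ∈ R, ad (Gd G S f e) (.inl u) (.inr t) with hb
  have hcrd : ∀ (L : Finset V) (R : Finset Bool), cr (Gd G S f e) (L.disjSum R) (L.disjSum R) =
      cr G L L + 2 * b L R + ∑ s ∈ R, ∑ t ∈ R, ad (Gd G S f e) (.inr s) (.inr t) := by
    intro L R
    have hsw : ∑ t ∈ R, ∑ u ∈ L, ad (Gd G S f e) (.inr t) (.inl u) = b L R := by
      rw [hb, Finset.sum_comm]
      exact Finset.sum_congr rfl fun _ _ => Finset.sum_congr rfl fun _ _ => ad_comm _ _ _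
    simp only [cr, Finset.sum_disjSum, Finset.sum_add_distrib, ad_ll]
    rw [hsw]; ring
  have hrow : ∀ u (R : Finset Bool), ∑ t ∈ R, ad (Gd G S f e) (.inl u) (.inr t) =
      if (∃ s ∈ S, G.Adj u s) ∧ f u ∈ R then 1 else 0 := by
    intro u R
    by_cases hu : ∃ s ∈ S, G.Adj u s
    · have : ∀ t, ad (Gd G S f e) (.inl u) (.inr t) = if f u = t then 1 else 0 := by
        intro t
        by_cases ht : f u = t
        · rw [ad_of (Gd G S f e) (u := .inl u) (v := .inr t) ⟨hu, ht⟩, if_pos ht]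
        · rw [ad_not (Gd G S f e) (u := .inl u) (v := .inr t) fun hh => ht hh.2, if_neg ht]
      simp [this, hu]
    · rw [Finset.sum_eq_zero fun t _ =>
        ad_not (Gd G S f e) (u := .inl u) (v := .inr t) fun hh => hu hh.1, if_neg fun hh => hu hh.1]
  have hrowS : ∀ u, (∃ s ∈ S, G.Adj u s) → 1 ≤ ∑ s ∈ S, ad G u s := by
    rintro u ⟨s, hs, hadj⟩
    simpa [cr] using cr_ge_one G (X := {u}) (Finset.mem_singleton_self u) hs hadj
  have hrowle : ∀ u (R : Finset Bool), ∑ t ∈ R, ad (Gd G S f e) (.inl u) (.inr t) ≤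
      ∑ s ∈ S, ad G u s := by
    intro u R
    rw [hrow]
    split_ifs with hh
    · exact hrowS u hh.1
    · exact Finset.sum_nonneg fun _ _ => ad_nonneg _ _ _
  have hble : ∀ L R, b L R ≤ cr G L S := fun L R => Finset.sum_le_sum fun u _ => hrowle u R
  have hval : ∀ v, wd w e v = 1 ∨ wd w e v = 4 ∨ wd w e v = 5 := by
    rintro (v | t)
    · exact h.val v
    · unfold wd; dsimp only; split_ifs <;> simp
  have hpot : ∀ (L : Finset V) (R : Finset Bool), pot (Gd G S f e) (wd w e) (L.disjSum R) =
      pot G w L - 4 * b L R + (∑ t ∈ R, wd w e (.inr t) -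
        2 * ∑ s ∈ R, ∑ t ∈ R, ad (Gd G S f e) (.inr s) (.inr t)) := by
    intro L R
    unfold pot
    rw [hcrd, Finset.sum_disjSum]
    simp only [wd]
    ring
  have hgap : ∀ L : Finset V, Disjoint L S → L.Nonempty → 1 ≤ pot G w L + pot G w S
      - 4 * cr G L S := by
    intro L hL hne
    rw [← pot_union G w hL]
    exact h.pos _ (hne.mono Finset.subset_union_left)
  have had : ∀ s t, ad (Gd G S f e) (.inr s) (.inr t) = if e ∧ s ≠ t then 1 else 0 := by
    intro s t
    by_cases hh : e ∧ s ≠ t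
    · rw [if_pos hh, ad_of _ hh]
    · rw [if_neg hh, ad_not _ hh]
  have hone : ∀ L : Finset V, Disjoint L S → ∀ t : Bool, (e → t = false) →
      0 < pot G w L - 4 * b L {t} + 1 := by
    intro L hL t ht
    rcases L.eq_empty_or_nonempty with rfl | hne
    · simp [pot, cr, hb]
    · have g := hgap L hL hne
      by_cases hall : ∀ y ∈ L, (∃ s ∈ S, G.Adj y s) → f y = t
      · have := hH L hL hne t ht hall
        rw [pot_union G w hL] at this
        have := hble L {t}
        linarith
      · push Not at hall
        obtain ⟨y, hy, hys, hyt⟩ := hall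
        have : b L {t} < cr G L S := by
          refine Finset.sum_lt_sum (fun u _ => hrowle u _) ⟨y, hy, ?_⟩
          rw [hrow, if_neg (by simp [hyt])]
          have := hrowS y hys
          omega
        linarith
  have hbig : ∀ (L : Finset V) (R : Finset Bool) (c : ℤ), Disjoint L S → 2 ≤ c →
      0 < pot G w L - 4 * b L R + c := by
    intro L R c hL hc
    rcases L.eq_empty_or_nonempty with rfl | hne
    · simp [pot, cr, hb]; omega
    · have := hgap L hL hne
      have := hble L R
      linarith
  have hpos : ∀ T : Finset (V ⊕ Bool), T ⊆ Sᶜ.disjSum Finset.univ → T.Nonempty →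
      0 < pot (Gd G S f e) (wd w e) T := by
    intro T hT hne
    rw [← T.toLeft_disjSum_toRight]
    have hL : Disjoint T.toLeft S := by
      rw [Finset.disjoint_left]
      intro x hx
      simpa using hT (Finset.mem_toLeft.1 hx)
    have hT' : T.toRight = ∅ → T.toLeft.Nonempty := by
      intro h0
      by_contra hc
      rw [Finset.not_nonempty_iff_eq_empty] at hc
      have := T.toLeft_disjSum_toRight
      rw [hc, h0] at this
      simp [← this] at hne
    generalize T.toLeft = L at hL hT'
    generalize T.toRight = R at hT'
    rw [hpot]
    have hR : R = ∅ ∨ R = {false} ∨ R = {true} ∨ R = Finset.univ := by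
      clear hT'; revert R; decide
    rcases hR with rfl | rfl | rfl | rfl
    · have := h.pos L (hT' rfl)
      simpa [hb] using this
    · have := hone L hL false (by simp)
      simpa [ad_self, wd] using this
    · by_cases he : e
      · have := hbig L {true} 5 hL (by norm_num)
        simpa [ad_self, wd, he] using this
      · have := hone L hL true (by simp [he])
        simpa [ad_self, wd, he] using this
    · apply hbig L _ _ hL
      simp only [Fintype.sum_bool, had, wd]
      by_cases he : e <;> simp [he]
  obtain ⟨A2, hA2⟩ := h.mini _ (Gd G S f e) (wd w e) (Sᶜ.disjSum Finset.univ) hval hpos (by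
    rw [hcrd, Finset.card_disjSum]
    have h1 := hble Sᶜ Finset.univ
    have h2 : cr G Finset.univ Finset.univ = cr G Sᶜ Sᶜ + cr G S S + 2 * cr G Sᶜ S := by
      rw [← cr_union G (disjoint_compl_left), Finset.union_comm, Finset.union_compl]
    have h3 : (Sᶜ.card : ℤ) + S.card = (Finset.univ : Finset V).card := by
      rw [add_comm]
      exact_mod_cast Finset.card_add_card_compl S
    have h4 : ∑ s, ∑ t, ad (Gd G S f e) (.inr s) (.inr t) ≤ 2 := by
      simp only [Fintype.sum_bool, had]
      by_cases he : e <;> simp [he]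
    have h5 : (3 : ℤ) ≤ S.card := by exact_mod_cast hcard
    have h6 : ((Finset.univ : Finset Bool).card : ℤ) = 2 := by simp
    push_cast
    rw [h2, ← h3, h6]
    linarith)
  have hfalse : Sum.inr false ∈ A2 := hA2.one _ (by simp) (by simp [wd])
  refine h.no ⟨_, gadget_lift hA hA2 (h.uniq hp) ?_⟩
  intro y hy s hs hadj
  by_cases he : e
  · rw [hf1 he y hy s hs hadj]
    have ht : Sum.inr true ∉ A2 := fun ht =>
      hA2.nadj _ ht _ hfalse (by simp) ⟨he, by simp⟩
    cases hfy : f y <;> simp [hfalse, ht]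
  · have : Sum.inr true ∈ A2 := hA2.one _ (by simp) (by simp [wd, he])
    simp only [hf2 he y hy s hs hadj, true_iff]
    cases f y <;> assumption

lemma MinC.small (h : MinC G w) {S : Finset V} {u : V} (hu : u ∈ S) (hwu : w u = 5)
    (hp : pot G w S ≤ 2) : 1 ≤ cr G S S := by
  have : w u ≤ ∑ v ∈ S, w v :=
    Finset.single_le_sum (f := w) (fun v _ => by linarith [h.wpos v]) hu
  unfold pot at hp
  omega

open scoped Classical in
/-- A proper set containing an unassigned vertex has potential at least two. -/
lemma MinC.claim1 (h : MinC G w) {S : Finset V} (hS : S ≠ Finset.univ) {u : V} (hu : u ∈ S)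
    (hwu : w u = 5) : 2 ≤ pot G w S := by
  by_contra hlt
  have hp0 := h.pos S ⟨u, hu⟩
  have hp : pot G w S = 1 := by omega
  obtain ⟨A, hA⟩ := h.sub0 hS
  have huniq := h.uniq (S := S) (by omega)
  refine h.gadget (fun y => decide (∃ s ∈ S, s ∉ A ∧ G.Adj y s)) True hA (by omega) ?_
    (h.small hu hwu (by omega)) ?_ (by simp) ?_
  · by_contra hc
    have h1 := cr_self_le G S
    have h2 : w u + ((S.card : ℤ) - 1) ≤ ∑ v ∈ S, w v := by
      rw [← Finset.add_sum_erase S _ hu]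
      have : ∑ v ∈ S.erase u, (1 : ℤ) ≤ ∑ v ∈ S.erase u, w v :=
        Finset.sum_le_sum fun v _ => h.wpos v
      simp at this
      have := Finset.card_erase_add_one hu
      omega
    have h3 : 0 < S.card := Finset.card_pos.2 ⟨u, hu⟩
    unfold pot at hp
    have h4 : S.card = 1 ∨ S.card = 2 := by omega
    rcases h4 with h4 | h4 <;> rw [h4] at h1 h2 <;> norm_num at h1 h2 <;> omega
  · intro _ y hy s hs hadj
    simp only [decide_eq_false_iff_not]
    constructor
    · rintro hsA ⟨t, ht, htA, hadj'⟩
      exact htA (huniq y hy s hs t ht hadj hadj' ▸ hsA)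
    · intro hn
      by_contra hsA
      exact hn ⟨s, hs, hsA, hadj⟩
  · intro L _ hne _ _ _
    have := h.pos (L ∪ S) (hne.mono Finset.subset_union_left)
    omega

/-- Reassigning one vertex. -/
lemma MinC.sub1 (h : MinC G w) {S : Finset V} (hS : S ≠ Finset.univ) {u : V} (hu : w u ≠ 1) :
    ∃ A, IFPart G w S A ∧ u ∉ A := by
  obtain ⟨A, hA⟩ := h.sub hS {u} (by
    intro T hT hne
    have hp := h.pos T hne
    simp only [Finset.mem_singleton, Finset.sum_ite_eq']
    split_ifs with huT
    · rcases h.val u with h1 | h1 | h1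
      · exact absurd h1 hu
      · omega
      · have := h.claim1 (S := T) (fun hh => hS (Finset.univ_subset_iff.1 (hh ▸ hT))) huT h1
        omega
    · exact hp)
  have huA : u ∉ A := fun hh => hA.four u (hA.sub u hh) (by simp) hh
  refine ⟨A, ⟨hA.sub, hA.nadj, hA.ncom, hA.spr, ?_, ?_⟩, huA⟩
  · intro v hv hwv
    refine hA.one v hv ?_
    have : v ≠ u := fun hh => hu (hh ▸ hwv)
    simp [this, hwv]
  · intro v hv hwv
    refine hA.four v hv ?_
    simp [hwv]

open scoped Classical in
/-- A proper set containing two unassigned vertices has potential at least three. -/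
lemma MinC.claim2 (h : MinC G w) {S : Finset V} (hS : S ≠ Finset.univ) {u v : V} (hu : u ∈ S)
    (hwu : w u = 5) (hv : v ∈ S) (hwv : w v = 5) (huv : u ≠ v) : 3 ≤ pot G w S := by
  by_contra hlt
  have hp0 := h.claim1 hS hu hwu
  have hp : pot G w S = 2 := by omega
  obtain ⟨A, hA⟩ := h.sub0 hS
  have huniq := h.uniq (S := S) (by omega)
  have hcr := h.small hu hwu (by omega)
  have hcard : 3 ≤ S.card := by
    by_contra hc
    have h1 := cr_self_le G S
    have h2 : w u + w v ≤ ∑ v ∈ S, w v := by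
      rw [← Finset.sum_pair huv]
      exact Finset.sum_le_sum_of_subset_of_nonneg
        (by intro a; simp; rintro (rfl | rfl) <;> assumption)
        (fun v _ _ => by linarith [h.wpos v])
    have h3 : 0 < S.card := Finset.card_pos.2 ⟨u, hu⟩
    unfold pot at hp
    have h4 : S.card = 1 ∨ S.card = 2 := by omega
    rcases h4 with h4 | h4 <;> rw [h4] at h1 <;> norm_num at h1 <;> omega
  have hbase : ∀ L : Finset V, L ∪ S ≠ Finset.univ → pot G w S ≤ pot G w (L ∪ S) := by
    intro L hL
    rw [hp]
    exact h.claim1 hL (Finset.mem_union_right _ hu) hwu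
  -- the connected gadget works unless the union is everything
  have hfirst : (∀ L : Finset V, Disjoint L S → L.Nonempty →
      (∀ y ∈ L, (∃ s ∈ S, G.Adj y s) → decide (∃ s ∈ S, s ∉ A ∧ G.Adj y s) = false) →
        pot G w S ≤ pot G w (L ∪ S)) → False := by
    intro hH
    refine h.gadget (fun y => decide (∃ s ∈ S, s ∉ A ∧ G.Adj y s)) True hA (by omega) hcard hcr
      ?_ (by simp) ?_
    · intro _ y hy s hs hadj
      simp only [decide_eq_false_iff_not]
      constructor
      · rintro hsA ⟨t, ht, htA, hadj'⟩
        exact htA (huniq y hy s hs t ht hadj hadj' ▸ hsA)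
      · intro hn
        by_contra hsA
        exact hn ⟨s, hs, hsA, hadj⟩
    · intro L hL hne t ht hall
      rw [ht trivial] at hall
      exact hH L hL hne hall
  by_cases hB : ∃ y, y ∉ S ∧ ∃ s ∈ S, s ∉ A ∧ G.Adj y s
  · obtain ⟨y, hy, s, hs, hsA, hadj⟩ := hB
    refine hfirst fun L hL hne hall => hbase L fun hLS => ?_
    have hyL : y ∈ L := by
      have : y ∈ L ∪ S := hLS ▸ Finset.mem_univ y
      simpa [hy] using this
    have := hall y hyL ⟨s, hs, hadj⟩
    simp only [decide_eq_false_iff_not] at this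
    exact this ⟨s, hs, hsA, hadj⟩
  have hall : ∀ y, y ∉ S → ∀ s ∈ S, G.Adj y s → s ∈ A := by
    intro y hy s hs hadj
    by_contra hsA
    exact hB ⟨y, hy, s, hs, hsA, hadj⟩
  by_cases hV : 2 ≤ pot G w Finset.univ
  · refine hfirst fun L hL hne _ => ?_
    by_cases hLS : L ∪ S = Finset.univ
    · rw [hLS, hp]; exact hV
    · exact hbase L hLS
  have hV1 : pot G w Finset.univ = 1 := by
    have := h.pos Finset.univ ⟨u, Finset.mem_univ u⟩
    omega
  by_cases htwo : ∃ y0 y1, y0 ≠ y1 ∧ y0 ∉ S ∧ y1 ∉ S ∧ (∃ s ∈ S, G.Adj y0 s) ∧ ∃ s ∈ S, G.Adj y1 s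
  · obtain ⟨y0, y1, hne, hy0, hy1, ha0, ha1⟩ := htwo
    refine h.gadget (fun y => decide (y = y0)) False hA (by omega) hcard hcr (by simp)
      (fun _ => hall) ?_
    intro L _ _ t _ hL
    refine hbase L fun hLS => ?_
    have hm : ∀ y, y ∉ S → y ∈ L := by
      intro y hy
      have : y ∈ L ∪ S := hLS ▸ Finset.mem_univ y
      simpa [hy] using this
    have e0 := hL y0 (hm y0 hy0) ha0
    have e1 := hL y1 (hm y1 hy1) ha1
    rw [← e1] at e0
    simp [hne.symm] at e0
  -- at most one edge leaves `S`
  have hScne : Sᶜ.Nonempty := by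
    rw [Finset.nonempty_iff_ne_empty]
    intro hh
    exact hS (by simpa using hh)
  have hsplit : pot G w Finset.univ = pot G w Sᶜ + pot G w S - 4 * cr G Sᶜ S := by
    rw [← pot_union G w (disjoint_compl_left), Finset.union_comm, Finset.union_compl]
  have hSc := h.pos _ hScne
  have hne0 : cr G Sᶜ S ≠ 0 := by
    intro h0
    rw [h0] at hsplit
    omega
  obtain ⟨y0, hy0, s0, hs0, hadj⟩ := exists_of_cr_ne G hne0
  have hy0' : y0 ∉ S := by simpa using hy0
  have honly : ∀ y, y ∉ S → ∀ s ∈ S, G.Adj y s → y = y0 ∧ s = s0 := by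
    intro y hy s hs ha
    have : y = y0 := by
      by_contra hyy
      exact htwo ⟨y, y0, hyy, hy, hy0', ⟨s, hs, ha⟩, s0, hs0, hadj⟩
    subst this
    exact ⟨rfl, huniq y hy s hs s0 hs0 ha hadj⟩
  have hcr1 : cr G Sᶜ S ≤ 1 := by
    unfold cr
    rw [Finset.sum_eq_single_of_mem y0 hy0]
    · exact cr_le_card G S Sᶜ (fun y hy => huniq y (by simpa using hy)) y0 hy0
    · intro y hy hne
      exact Finset.sum_eq_zero fun s hs =>
        ad_not G fun ha => hne (honly y (by simpa using hy) s hs ha).1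
  have hws : w s0 ≠ 1 := by
    intro hw
    have h1 := h.pos ({s0} ∪ Sᶜ) ⟨s0, by simp⟩
    rw [pot_union G w (by simpa using hs0), pot_singleton, hw] at h1
    have := cr_ge_one G (X := {s0}) (Finset.mem_singleton_self _) hy0 hadj.symm
    omega
  have hwy : w y0 ≠ 1 := by
    intro hw
    have h1 := h.pos ({y0} ∪ S) ⟨y0, by simp⟩
    rw [pot_union G w (by simpa using hy0'), pot_singleton, hw] at h1
    have := cr_ge_one G (X := {y0}) (Finset.mem_singleton_self _) hs0 hadj
    omega
  obtain ⟨A1, hA1, hs1⟩ := h.sub1 hS hws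
  obtain ⟨A2, hA2, hy2⟩ := h.sub1 (S := Sᶜ) (by
    intro hh
    have : u ∈ Sᶜ := hh ▸ Finset.mem_univ u
    simp [hu] at this) hwy
  have hA2S : ∀ x ∈ A2, x ∉ S := fun x hx => by simpa using hA2.sub x hx
  have hm1 : ∀ a ∈ A1, ∀ y ∈ A2, ¬ G.Adj a y := by
    intro a ha y hy hadj'
    exact hs1 ((honly y (hA2S y hy) a (hA1.sub a ha) hadj'.symm).2 ▸ ha)
  have hm2 : ∀ a ∈ A1, ∀ y ∈ A2, ∀ m, G.Adj a m → G.Adj m y → False := by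
    intro a ha y hy m h1 h2
    by_cases hm : m ∈ S
    · exact hy2 ((honly y (hA2S y hy) m hm h2.symm).1 ▸ hy)
    · exact hs1 ((honly m hm a (hA1.sub a ha) h1.symm).2 ▸ ha)
  refine h.no ⟨A1 ∪ A2, by simp, ?_, ?_, ?_, ?_, ?_⟩
  · intro a ha b hb hab hadj'
    rw [Finset.mem_union] at ha hb
    rcases ha with ha | ha <;> rcases hb with hb | hb
    · exact hA1.nadj a ha b hb hab hadj'
    · exact hm1 a ha b hb hadj'
    · exact hm1 b hb a ha hadj'.symm
    · exact hA2.nadj a ha b hb hab hadj'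
  · intro a ha b hb hab m _ h1 h2
    rw [Finset.mem_union] at ha hb
    rcases ha with ha | ha <;> rcases hb with hb | hb
    · by_cases hm : m ∈ S
      · exact hA1.ncom a ha b hb hab m hm h1 h2
      · exact hs1 ((honly m hm a (hA1.sub a ha) h1.symm).2 ▸ ha)
    · exact hm2 a ha b hb m h1 h2
    · exact hm2 b hb a ha m h2.symm h1.symm
    · by_cases hm : m ∈ S
      · exact hy2 ((honly a (hA2S a ha) m hm h1).1 ▸ ha)
      · exact hA2.ncom a ha b hb hab m (by simpa using hm) h1 h2
  · intro X hX hXne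
    simp only [Set.mem_ofPred_eq, Finset.mem_union, not_or, Finset.mem_univ, true_and] at hX
    set X1 := X.filter (· ∈ S) with hX1
    set X2 := X.filter (· ∉ S) with hX2
    have hd : Disjoint X1 X2 := Finset.disjoint_filter_filter_not _ _ _
    have hU : X1 ∪ X2 = X := Finset.filter_union_filter_not_eq _ _
    have hc : (X.card : ℤ) = X1.card + X2.card := by
      rw [← hU, Finset.card_union_of_disjoint hd]; push_cast; rfl
    rw [← hU, cr_union G hd, hU, hc]
    have s1 : X1.Nonempty → cr G X1 X1 + 2 ≤ 2 * (X1.card : ℤ) := hA1.spr X1 (by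
      intro x hx
      simp only [hX1, Finset.mem_filter] at hx
      exact ⟨hx.2, (hX x hx.1).1⟩)
    have s2 : X2.Nonempty → cr G X2 X2 + 2 ≤ 2 * (X2.card : ℤ) := hA2.spr X2 (by
      intro x hx
      simp only [hX2, Finset.mem_filter] at hx
      exact ⟨by simpa using hx.2, (hX x hx.1).2⟩)
    have s3 : cr G X1 X2 ≤ 1 := by
      refine le_trans (cr_mono G (X' := S) (Y' := Sᶜ) ?_ ?_) (cr_comm G S Sᶜ ▸ hcr1)
      · intro x hx; exact (Finset.mem_filter.1 hx).2
      · intro x hx; simpa using (Finset.mem_filter.1 hx).2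
    rcases X1.eq_empty_or_nonempty with h1 | h1
    · rcases X2.eq_empty_or_nonempty with h2 | h2
      · rw [h1, h2] at hU
        simp [← hU] at hXne
      · have := s2 h2
        simp [h1, cr] at this ⊢
        exact this
    · rcases X2.eq_empty_or_nonempty with h2 | h2
      · have := s1 h1
        simp [h2, cr] at this ⊢
        exact this
      · have := s1 h1
        have := s2 h2
        linarith
  · intro x _ hx
    rw [Finset.mem_union]
    by_cases hxS : x ∈ S
    · exact Or.inl (hA1.one x hxS hx)
    · exact Or.inr (hA2.one x (by simpa using hxS) hx)
  · intro x _ hx hmem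
    rw [Finset.mem_union] at hmem
    rcases hmem with hh | hh
    · exact hA1.four x (hA1.sub x hh) hx hh
    · exact hA2.four x (hA2.sub x hh) hx hh

/-- The abstract form of the main result. -/
lemma MinC.main (h : MinC G w) {S : Finset V} (hS : S ≠ Finset.univ) (M : Finset V)
    (hMw : ∀ v ∈ M, w v = 5) (hcard : M.card ≤ 2) :
    ∃ A, IFPart G (fun v => if v ∈ M then 4 else w v) S A := by
  apply h.sub hS
  intro T hT hne
  have hTu : T ≠ Finset.univ := fun hh => hS (Finset.univ_subset_iff.1 (hh ▸ hT))
  have h1 : ∑ v ∈ T, (if v ∈ M then w v - 4 else 0) = ((T ∩ M).card : ℤ) := by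
    rw [← Finset.sum_filter, Finset.filter_mem_eq_inter, Finset.card_eq_sum_ones]
    push_cast
    refine Finset.sum_congr rfl fun v hv => ?_
    rw [hMw v (Finset.mem_inter.1 hv).2]; norm_num
  rw [h1]
  have h2 : (T ∩ M).card ≤ 2 := (Finset.card_le_card Finset.inter_subset_right).trans hcard
  have h3 := h.pos T hne
  by_cases h4 : (T ∩ M).card = 0
  · rw [h4]; simpa using h3
  obtain ⟨a, ha⟩ := Finset.card_pos.1 (Nat.pos_of_ne_zero h4)
  rw [Finset.mem_inter] at ha
  have h5 := h.claim1 hTu ha.1 (hMw a ha.2)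
  by_cases h6 : (T ∩ M).card = 1
  · rw [h6]; push_cast; omega
  obtain ⟨a, ha, b, hb, hab⟩ := Finset.one_lt_card.1 (show 1 < (T ∩ M).card by omega)
  rw [Finset.mem_inter] at ha hb
  have := h.claim2 hTu ha.1 (hMw a ha.2) hb.1 (hMw b hb.2) hab
  omega

end core

section interface

open scoped Classical in
lemma two_edges {V : Type*} [Fintype V] (H : SimpleGraph V) :
    2 * (Nat.card H.edgeSet : ℤ) = cr H Finset.univ Finset.univ := by
  have h1 := H.sum_degrees_eq_twice_card_edges
  have h2 : Nat.card H.edgeSet = H.edgeFinset.card := by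
    rw [Nat.card_eq_fintype_card, SimpleGraph.edgeFinset_card]
  rw [h2]
  have h3 : ((∑ v, H.degree v : ℕ) : ℤ) = 2 * (H.edgeFinset.card : ℤ) := by
    rw [h1]; push_cast; rfl
  rw [← h3]
  push_cast
  unfold cr
  refine Finset.sum_congr rfl fun u _ => ?_
  rw [← SimpleGraph.card_neighborFinset_eq_degree, SimpleGraph.neighborFinset_eq_filter]
  simp [ad]

lemma cr_map {V W : Type*} (g : V ↪ W) (G : SimpleGraph W) (X Y : Finset V) :
    cr G (X.map g) (Y.map g) = cr (G.comap g) X Y := by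
  simp only [cr, Finset.sum_map]; rfl

lemma pot_map {V W : Type*} (g : V ↪ W) (G : SimpleGraph W) (w : W → ℤ) (X : Finset V) :
    pot G w (X.map g) = pot (G.comap g) (w ∘ g) X := by
  simp only [pot, cr_map, Finset.sum_map]; rfl

open scoped Classical in
lemma edges_acyclic {V : Type*} [Fintype V] [Nonempty V] (H : SimpleGraph V) (h : H.IsAcyclic) :
    cr H Finset.univ Finset.univ + 2 ≤ 2 * (Fintype.card V : ℤ) := by
  obtain ⟨T, hT, htree⟩ := SimpleGraph.Connected.exists_isTree_le_of_le_of_isAcyclic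
    (G := (⊤ : SimpleGraph V)) SimpleGraph.connected_top le_top h
  have h1 := htree.2.card_edgeFinset
  have h2 := Finset.card_le_card (SimpleGraph.edgeFinset_mono hT)
  rw [← two_edges, Nat.card_eq_fintype_card, ← SimpleGraph.edgeFinset_card]
  omega

open scoped Classical in
lemma acyc_iff {V : Type*} [Fintype V] (G : SimpleGraph V) (K : Set V) :
    (G.induce K).IsAcyclic ↔ Spr G K := by
  constructor
  · intro h X hX hne
    have hac : (G.comap (Function.Embedding.subtype (· ∈ X))).IsAcyclic := by
      refine SimpleGraph.IsAcyclic.comap (G' := G.induce K)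
        ⟨fun x => ⟨x.1, hX x.1 x.2⟩, fun {a b} hab => hab⟩ ?_ h
      intro a b hab
      exact Subtype.ext (congrArg Subtype.val hab :)
    have : Nonempty {x // x ∈ X} := hne.to_subtype
    have := edges_acyclic _ hac
    rw [← cr_map] at this
    have hX' : (Finset.univ : Finset {x // x ∈ X}).map (Function.Embedding.subtype (· ∈ X)) = X := by
      ext x; simp
    rw [hX'] at this
    simpa using this
  · intro h v c hc
    set X : Finset V := (c.support.map Subtype.val).toFinset with hX
    have hXm : ∀ x, x ∈ X ↔ ∃ y ∈ c.support, y.1 = x := by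
      intro x; simp [hX]
    have h1 := h X (by
      intro x hx
      obtain ⟨y, _, rfl⟩ := (hXm x).1 hx
      exact y.2) ⟨v.1, (hXm _).2 ⟨v, c.start_mem_support, rfl⟩⟩
    have h2 : ∀ x ∈ X, 2 ≤ ∑ y ∈ X, ad G x y := by
      intro x hx
      obtain ⟨x', hx', rfl⟩ := (hXm x).1 hx
      have h3 := hc.ncard_neighborSet_toSubgraph_eq_two hx'
      obtain ⟨a, b, hab, hset⟩ := Set.ncard_eq_two.1 h3
      have key : ∀ a, a ∈ c.toSubgraph.neighborSet x' → a.1 ∈ X ∧ G.Adj x'.1 a.1 := by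
        intro a ha
        have ha' : c.toSubgraph.Adj x' a := ha
        refine ⟨(hXm _).2 ⟨a, ?_, rfl⟩, ha'.adj_sub⟩
        exact c.mem_verts_toSubgraph.1 ha'.snd_mem
      have ha := key a (by rw [hset]; simp)
      have hb := key b (by rw [hset]; simp)
      have := cr_two_le G ha.1 hb.1 (fun hh => hab (Subtype.ext hh)) ha.2 hb.2
      simpa [cr] using this
    have h4 : ∑ x ∈ X, (2 : ℤ) ≤ cr G X X := Finset.sum_le_sum h2
    simp at h4
    linarith

open scoped Classical in
/-- Weights attached to an assignment. -/
noncomputable def wt {V : Type*} (I F : Set V) (v : V) : ℤ :=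
  if v ∈ I then 1 else if v ∈ F then 4 else 5

lemma wt_val {V : Type*} (I F : Set V) (v : V) : wt I F v = 1 ∨ wt I F v = 4 ∨ wt I F v = 5 := by
  unfold wt; split_ifs <;> simp

open scoped Classical in
lemma wt_sum {V : Type*} [Fintype V] {I F U : Set V} (h : IsAssignment I F U) (T : Finset V) :
    (((T : Set V) ∩ I).ncard : ℤ) + 4 * ((T : Set V) ∩ F).ncard + 5 * ((T : Set V) ∩ U).ncard
      = ∑ v ∈ T, wt I F v := by
  have hc : ∀ J : Set V, (((T : Set V) ∩ J).ncard : ℤ) = ∑ v ∈ T, if v ∈ J then (1 : ℤ) else 0 := by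
    intro J
    have : (T : Set V) ∩ J = ((T.filter (· ∈ J) : Finset V) : Set V) := by ext; simp
    rw [this, Set.ncard_coe_finset]
    simp
  rw [hc, hc, hc, Finset.mul_sum, Finset.mul_sum, ← Finset.sum_add_distrib,
    ← Finset.sum_add_distrib]
  refine Finset.sum_congr rfl fun v _ => ?_
  obtain ⟨h1, h2, h3, h4⟩ := h
  have hv : v ∈ I ∪ F ∪ U := h1 ▸ Set.mem_univ v
  rw [Set.disjoint_left] at h2 h3 h4
  have := @h2 v
  have := @h3 v
  have := @h4 v
  simp only [Set.mem_union] at hv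
  unfold wt
  by_cases a1 : v ∈ I <;> by_cases a2 : v ∈ F <;> by_cases a3 : v ∈ U <;> simp_all

open scoped Classical in
lemma pot_of_rho {V : Type*} [Fintype V] {G : SimpleGraph V} {I F U : Set V}
    (h : IsAssignment I F U)
    (hr : ∀ H : G.Subgraph, H.verts.Nonempty → 0 < rho G I F U H) (T : Finset V)
    (hT : T.Nonempty) : 0 < pot G (wt I F) T := by
  have h1 := hr ((⊤ : G.Subgraph).induce (T : Set V)) (by simpa using hT)
  unfold rho at h1
  have h2 := two_edges ((⊤ : G.Subgraph).induce (T : Set V)).spanningCoe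
  rw [SimpleGraph.Subgraph.edgeSet_spanningCoe] at h2
  have h3 : cr ((⊤ : G.Subgraph).induce (T : Set V)).spanningCoe Finset.univ Finset.univ
      = cr G T T := by
    unfold cr
    rw [← Finset.sum_subset (Finset.subset_univ T)]
    · refine Finset.sum_congr rfl fun u hu => ?_
      rw [← Finset.sum_subset (Finset.subset_univ T)]
      · refine Finset.sum_congr rfl fun v hv => ?_
        simp [ad, hu, hv]
      · intro v _ hv
        exact ad_not _ (by simp [hv])
    · intro u _ hu
      exact Finset.sum_eq_zero fun v _ => ad_not _ (by simp [hu])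
  rw [SimpleGraph.Subgraph.induce_verts, wt_sum h] at h1
  unfold pot
  linarith

open scoped Classical in
lemma rho_of_pot {V : Type*} [Fintype V] {G : SimpleGraph V} {I F U : Set V}
    (h : IsAssignment I F U)
    (hr : ∀ T : Finset V, T.Nonempty → 0 < pot G (wt I F) T) (H : G.Subgraph)
    (hH : H.verts.Nonempty) : 0 < rho G I F U H := by
  have h1 := hr H.verts.toFinset (by simpa using hH)
  have h2 := two_edges H.spanningCoe
  rw [SimpleGraph.Subgraph.edgeSet_spanningCoe] at h2
  have h3 : cr H.spanningCoe Finset.univ Finset.univ ≤ cr G H.verts.toFinset H.verts.toFinset := by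
    unfold cr
    rw [← Finset.sum_subset (Finset.subset_univ H.verts.toFinset)]
    · refine Finset.sum_le_sum fun u hu => ?_
      rw [← Finset.sum_subset (Finset.subset_univ H.verts.toFinset)]
      · refine Finset.sum_le_sum fun v hv => ?_
        by_cases hh : H.Adj u v
        · rw [ad_of _ (show H.spanningCoe.Adj u v from hh), ad_of _ hh.adj_sub]
        · rw [ad_not _ (show ¬ H.spanningCoe.Adj u v from hh)]
          exact ad_nonneg _ _ _
      · intro v _ hv
        exact ad_not _ fun hh => hv (by simpa using SimpleGraph.Subgraph.Adj.snd_mem hh)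
    · intro u _ hu
      exact Finset.sum_eq_zero fun v _ => ad_not _ fun hh =>
        hu (by simpa using SimpleGraph.Subgraph.Adj.fst_mem hh)
  have h4 := wt_sum h H.verts.toFinset
  rw [Set.coe_toFinset] at h4
  unfold rho
  rw [h4]
  unfold pot at h1
  linarith

open scoped Classical in
lemma minC_of {V : Type u} [Fintype V] {G : SimpleGraph V} {I F U : Set V}
    (hmin : IsMinCounterexample G I F U) : MinC G (wt I F) := by
  obtain ⟨⟨has, hrho, hno⟩, hm⟩ := hmin
  refine ⟨wt_val I F, pot_of_rho has hrho, ?_, ?_⟩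
  · rintro ⟨A, hA⟩
    refine hno ⟨A, {x | x ∉ A}, ⟨?_, ?_, ?_, ?_⟩, ?_, ?_⟩
    · ext x; simp [em]
    · rw [Set.disjoint_left]; intro x hx hx'; exact hx' hx
    · intro a ha b hb hab
      exact ⟨hA.nadj a ha b hb hab, fun m hm =>
        hA.ncom a ha b hb hab m (Finset.mem_univ m) hm.1 hm.2⟩
    · rw [acyc_iff]
      exact hA.spr.mono fun x hx => ⟨Finset.mem_univ x, hx⟩
    · intro x hx
      exact hA.one x (Finset.mem_univ x) (by simp [wt, hx])
    · intro x hx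
      refine hA.four x (Finset.mem_univ x) ?_
      have : x ∉ I := fun hI => Set.disjoint_left.1 has.2.1 hI hx
      simp [wt, hx, this]
  · intro W _ G2 w2 K hval hpos hsize
    set g : Fin K.card ↪ W :=
      ⟨fun i => (K.equivFin.symm i : W), fun i j hij => by
        simpa using Subtype.ext hij⟩ with hg
    have hgK : ∀ i, g i ∈ K := fun i => (K.equivFin.symm i).2
    have hsurj : ∀ x ∈ K, ∃ i, g i = x := fun x hx =>
      ⟨K.equivFin ⟨x, hx⟩, congrArg Subtype.val (K.equivFin.symm_apply_apply ⟨x, hx⟩)⟩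
    have hmapu : (Finset.univ : Finset (Fin K.card)).map g = K := by
      ext x
      simp only [Finset.mem_map, Finset.mem_univ, true_and]
      constructor
      · rintro ⟨i, rfl⟩; exact hgK i
      · exact hsurj x
    by_contra hcon
    have hwt : wt {i | w2 (g i) = 1} {i | w2 (g i) = 4} = w2 ∘ g := by
      funext i
      rcases hval (g i) with h | h | h <;> simp [wt, h]
    have hass : IsAssignment {i | w2 (g i) = 1} {i | w2 (g i) = 4} {i | w2 (g i) = 5} := by
      refine ⟨?_, ?_, ?_, ?_⟩
      · ext i
        rcases hval (g i) with h | h | h <;> simp [h]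
      all_goals
        rw [Set.disjoint_left]
        intro i hi hi'
        simp only [Set.mem_ofPred_eq] at hi hi'
        omega
    have hc : IsCounterexample (G2.comap g) {i | w2 (g i) = 1} {i | w2 (g i) = 4}
        {i | w2 (g i) = 5} := by
      refine ⟨hass, rho_of_pot hass ?_, ?_⟩
      · intro T hT
        rw [hwt, ← pot_map]
        refine hpos _ ?_ (by simpa using hT)
        intro x hx
        obtain ⟨i, _, rfl⟩ := Finset.mem_map.1 hx
        exact hgK i
      · rintro ⟨A, B, ⟨hAB, hdis, hind, hac⟩, hIA, hFB⟩
        have hmemB : ∀ i, i ∉ A → i ∈ B := by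
          intro i hi
          have : i ∈ A ∪ B := hAB ▸ Set.mem_univ i
          exact this.resolve_left hi
        have hAmem : ∀ i, g i ∈ A.toFinset.map g ↔ i ∈ A := by intro i; simp
        refine hcon ⟨A.toFinset.map g, ?_, ?_, ?_, ?_, ?_, ?_⟩
        · intro x hx
          obtain ⟨i, _, rfl⟩ := Finset.mem_map.1 hx
          exact hgK i
        · intro a ha b hb hab
          obtain ⟨i, hi, rfl⟩ := Finset.mem_map.1 ha
          obtain ⟨j, hj, rfl⟩ := Finset.mem_map.1 hb
          exact (hind i (by simpa using hi) j (by simpa using hj) fun h => hab (by rw [h])).1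
        · intro a ha b hb hab m hmK h1 h2
          obtain ⟨i, hi, rfl⟩ := Finset.mem_map.1 ha
          obtain ⟨j, hj, rfl⟩ := Finset.mem_map.1 hb
          obtain ⟨k, rfl⟩ := hsurj m hmK
          exact (hind i (by simpa using hi) j (by simpa using hj) fun h => hab (by rw [h])).2 k
            ⟨h1, h2⟩
        · intro X hX hne
          rw [acyc_iff] at hac
          set Y : Finset (Fin K.card) := Finset.univ.filter (fun i => g i ∈ X) with hY
          have hXY : Y.map g = X := by
            ext x
            simp only [hY, Finset.mem_map, Finset.mem_filter, Finset.mem_univ, true_and]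
            constructor
            · rintro ⟨i, hi, rfl⟩; exact hi
            · intro hx
              obtain ⟨i, rfl⟩ := hsurj x (hX x hx).1
              exact ⟨i, hx, rfl⟩
          have := hac Y (by
            intro i hi
            have hi' : g i ∈ X := (Finset.mem_filter.1 hi).2
            exact hmemB i fun hiA => (hX _ hi').2 ((hAmem i).2 hiA)) (by
              rw [← hXY] at hne; simpa using hne)
          rw [← hXY, cr_map, Finset.card_map]
          exact this
        · intro x hx hw
          obtain ⟨i, rfl⟩ := hsurj x hx
          exact (hAmem i).2 (hIA hw)
        · intro x hx hw hmem
          obtain ⟨i, rfl⟩ := hsurj x hx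
          exact Set.disjoint_left.1 hdis ((hAmem i).1 hmem) (hFB hw)
    have h1 := hm _ _ _ _ _ hc
    have h2 := two_edges (G2.comap g)
    rw [← cr_map, hmapu] at h2
    have h3 := two_edges G
    unfold edgeCount at h1
    rw [Finset.card_univ] at hsize
    omega

end interface

/-- Lemma 3.6: let `G` be a minimal counterexample and `S` a nonempty proper subset of
`V(G)`.  If `G'` is obtained from `G` by reassigning a set `M` of at most two vertices of
`S` from `U` to `F` (so the new assignment is `I ⊔ (F ∪ M) ⊔ (U \ M)`), then the induced
assigned subgraph `G'[S]` has an I,F-partition extending its assignment. -/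
theorem induced_has_ifPartition_after_reassign {V : Type*} [Fintype V] (G : SimpleGraph V)
    (I F U : Set V) (hmin : IsMinCounterexample G I F U)
    (S : Set V) (hS : S.Nonempty) (hproper : S ≠ Set.univ)
    (M : Set V) (hM : M ⊆ S ∩ U) (hMcard : M.ncard ≤ 2) :
    ∃ A B : Set ↑S, IsIFPartition (G.induce S) A B ∧
      (∀ x : ↑S, (x : V) ∈ I → x ∈ A) ∧
      (∀ x : ↑S, (x : V) ∈ F ∪ M → x ∈ B) := by
  classical
  have hC := minC_of hmin
  have has := hmin.1.1
  have hMI : ∀ v ∈ M, v ∉ I := fun v hv hI => Set.disjoint_left.1 has.2.2.1 hI (hM hv).2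
  have hMF : ∀ v ∈ M, v ∉ F := fun v hv hF => Set.disjoint_left.1 has.2.2.2 hF (hM hv).2
  obtain ⟨A, hA⟩ := hC.main (S := S.toFinset) (by
      intro hh
      exact hproper (by simpa using hh)) M.toFinset (by
      intro v hv
      have hv' : v ∈ M := by simpa using hv
      simp [wt, hMI v hv', hMF v hv']) (by
      rwa [← Set.ncard_eq_toFinset_card'])
  refine ⟨{x | (x : V) ∈ A}, {x | (x : V) ∉ A}, ⟨?_, ?_, ?_, ?_⟩, ?_, ?_⟩
  · ext x; simp [em]
  · rw [Set.disjoint_left]; intro x hx hx'; exact hx' hx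
  · intro a ha b hb hab
    have hab' : (a : V) ≠ b := fun h => hab (Subtype.ext h)
    exact ⟨hA.nadj a ha b hb hab', fun m hm =>
      hA.ncom a ha b hb hab' m (by simp) hm.1 hm.2⟩
  · have h1 := (acyc_iff G _).2 hA.spr
    refine SimpleGraph.IsAcyclic.comap
      ⟨fun x => ⟨x.1.1, by simp, x.2⟩, fun {a b} hab => hab⟩ ?_ h1
    intro a b hab
    exact Subtype.ext (Subtype.ext (congrArg Subtype.val hab :))
  · intro x hx
    refine hA.one x (by simp) ?_
    have : (x : V) ∉ M := fun h => hMI _ h hx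
    simp [this, wt, hx]
  · intro x hx
    refine hA.four x (by simp) ?_
    by_cases hxM : (x : V) ∈ M
    · simp [hxM]
    · have hF : (x : V) ∈ F := hx.resolve_right hxM
      have : (x : V) ∉ I := fun h => Set.disjoint_left.1 has.2.1 h hF
      simp [hxM, wt, hF, this]
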